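/- arXiv:math/0001127 — 2 statements merged into one kernel-verified Lean document; each statement's English description precedes it below -/
import Mathlib

section
/- Let 𝔤 be a Lie algebra over k, let p ≥ 1, q ≥ 0, r ≥ 1, and let x_1,…,x_{p+q}, y_1,…,y_r ∈ 𝔤. Then B_p(x_1⋯x_{p+q}, y_1⋯y_r) = Σ_{k=0}^{r-1} c_k(q) · Σ_{S ⊂ {1,…,p+q}, #S = q+k} x_S · B_p(x_{S^c}, y_1⋯y_r), where S^c denotes the complement of S in {1,…,p+q}. -/
noncomputable section

/-- The degree-`n` homogeneous component `S^n` of the symmetric algebra: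
the span of `n`-fold products of elements of `𝔤` (realized as the `n`-th power of the
submodule `ι(𝔤) ⊆ S`). -/
def Sdeg (k : Type) [Field k] (L : Type) [LieRing L] [LieAlgebra k L]
    (S : Type) [CommRing S] [Algebra k S] (ι : L →ₗ[k] S) (n : ℕ) : Submodule k S :=
  (LinearMap.range ι) ^ n

/-- `(S, ι)` is a model of the symmetric algebra of the Lie algebra `L`:
`S` is commutative and generated as a `k`-algebra by the image of `ι`. -/
def IsSymmAlg (k : Type) [Field k] (L : Type) [LieRing L] [LieAlgebra k L]
    (S : Type) [CommRing S] [Algebra k S] (ι : L →ₗ[k] S) : Prop :=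
  Algebra.adjoin k (Set.range ι) = ⊤

/-- `e : S → U𝔤` is the symmetrization map: it sends a monomial `g₁ ⋯ g_p` to
`(1/p!) ∑_{σ ∈ S_p} g_{σ(1)} ⋯ g_{σ(p)}`. -/
def IsSymmetrization (k : Type) [Field k] (L : Type) [LieRing L] [LieAlgebra k L]
    (S : Type) [CommRing S] [Algebra k S] (ι : L →ₗ[k] S)
    (e : S →ₗ[k] UniversalEnvelopingAlgebra k L) : Prop :=
  ∀ l : List L,
    e (l.map ι).prod = ((l.length.factorial : k)⁻¹) •
      ∑ σ : Equiv.Perm (Fin l.length),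
        (List.ofFn fun i => UniversalEnvelopingAlgebra.ι k (l.get (σ i))).prod

/-- `B : ℕ → S →ₗ S →ₗ S` is the family of homogeneous components `B_p` of the product
`B(x,y) = e⁻¹(e(x)e(y))`: each `B p` lowers total degree by `p` (it maps `S^n ⊗ S^m`
to `S^{n+m-p}` and vanishes for `p > n+m`), and on homogeneous elements `x ∈ S^n`,
`y ∈ S^m` one has `e (∑_{p=0}^{n+m} B p x y) = e x * e y`, i.e.
`e⁻¹(e(x)e(y)) = ∑_p B_p(x,y)`. -/
def IsPBWComponents (k : Type) [Field k] (L : Type) [LieRing L] [LieAlgebra k L]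
    (S : Type) [CommRing S] [Algebra k S] (ι : L →ₗ[k] S)
    (e : S →ₗ[k] UniversalEnvelopingAlgebra k L)
    (B : ℕ → S →ₗ[k] S →ₗ[k] S) : Prop :=
  (∀ p n m, ∀ x ∈ Sdeg k L S ι n, ∀ y ∈ Sdeg k L S ι m,
      B p x y ∈ Sdeg k L S ι (n + m - p)) ∧
  (∀ p n m, n + m < p → ∀ x ∈ Sdeg k L S ι n, ∀ y ∈ Sdeg k L S ι m, B p x y = 0) ∧
  (∀ n m, ∀ x ∈ Sdeg k L S ι n, ∀ y ∈ Sdeg k L S ι m,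
      e (∑ p ∈ Finset.range (n + m + 1), B p x y) = e x * e y)


/-- The rational numbers `c_k(q)` of the paper, defined recursively by
`c_0(q) = 1` and `c_k(q) = 1 - ∑_{l=0}^{k-1} c_l(q) * (q+k).choose (k-l)` for `k ≥ 1`.
Here `paperC q k` denotes `c_k(q)`. -/
def paperC (q : ℕ) : ℕ → ℚ
  | 0 => 1
  | (k + 1) =>
      1 - ∑ l : Fin (k + 1), paperC q l * ((q + (k + 1)).choose ((k + 1) - l))
  termination_by k => k
  decreasing_by exact l.isLt

section Polarization

variable {k A : Type*} [Field k] [CharZero k] [CommRing A] [Algebra k A]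

/-- The coefficients of a polynomial map lie in every subspace containing all its values. -/
theorem mem_of_forall_sum_pow_smul_mem {M : Type*} [AddCommGroup M] [Module k M]
    (W : Submodule k M) (n : ℕ) (a : ℕ → M)
    (h : ∀ t : k, ∑ i ∈ Finset.range n, t ^ i • a i ∈ W) {i : ℕ} (hi : i < n) : a i ∈ W := by
  rw [← Submodule.Quotient.mk_eq_zero W, ← Module.forall_dual_apply_eq_zero_iff k]
  intro φ
  set φ' : M →ₗ[k] k := φ.comp W.mkQ with hφ'
  have h0 : (∑ j ∈ Finset.range n, Polynomial.monomial j (φ' (a j)) : Polynomial k) = 0 := by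
    refine Polynomial.funext fun t => ?_
    have h1 : φ' (∑ j ∈ Finset.range n, t ^ j • a j) = 0 := by
      simp only [hφ', LinearMap.comp_apply, Submodule.mkQ_apply,
        (Submodule.Quotient.mk_eq_zero W).mpr (h t), map_zero]
    simpa [Polynomial.eval_finsetSum, mul_comm] using h1
  have h2 := congrArg (fun P => Polynomial.coeff P i) h0
  simpa [hφ', Polynomial.finsetSum_coeff, Polynomial.coeff_monomial, hi] using h2

/-- Polarization: in characteristic zero, `V ^ n` is spanned by the `n`-th powers. -/
theorem pow_le_of_forall_pow_mem (V W : Submodule k A) (n : ℕ)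
    (h : ∀ v ∈ V, v ^ n ∈ W) : V ^ n ≤ W := by
  have key : ∀ j m, j + m = n → ∀ v ∈ V, ∀ u ∈ V ^ j, v ^ m * u ∈ W := by
    intro j
    induction j with
    | zero =>
      rintro m hm v hv u hu
      rw [pow_zero] at hu
      obtain ⟨c, rfl⟩ := Submodule.mem_one.mp hu
      obtain rfl : m = n := by omega
      rw [mul_comm, ← Algebra.smul_def]
      exact W.smul_mem _ (h v hv)
    | succ j ih =>
      rintro m hm v hv u hu
      rw [pow_succ'] at hu
      induction hu using Submodule.mul_induction_on' with
      | add x _ y _ hx hy => rw [mul_add]; exact W.add_mem hx hy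
      | mem_mul_mem w hw u' hu' =>
        have h1 := mem_of_forall_sum_pow_smul_mem (k := k) W (m + 2)
          (fun i => (w ^ i * v ^ (m + 1 - i) * ((m + 1).choose i : A)) * u') (fun t => by
            have h2 := ih (m + 1) (by omega) (t • w + v)
              (V.add_mem (V.smul_mem _ hw) hv) u' hu'
            rw [add_pow, Finset.sum_mul] at h2
            simpa [smul_pow] using h2) (i := 1) (by omega)
        have h3 : ((m + 1 : k)⁻¹) • ((m + 1 : k) • (v ^ m * (w * u'))) = v ^ m * (w * u') := by
          rw [smul_smul, inv_mul_cancel₀ (by exact_mod_cast m.succ_ne_zero), one_smul]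
        rw [← h3]
        refine W.smul_mem _ ?_
        convert h1 using 1
        simp [Algebra.smul_def]
        ring
  intro u hu
  cases n with
  | zero => simpa using key 0 0 rfl 0 V.zero_mem u hu
  | succ n => simpa using key (n + 1) 0 rfl 0 V.zero_mem u hu

end Polarization

section Independence

variable {k A : Type*} [Field k] [CommRing A] [Algebra k A]

/-- If some operator acts on `V ^ n` by `2 ^ n` for every `n`, these subspaces are independent. -/
theorem iSupIndep_pow_of_doubling [CharZero k] (V : Submodule k A) (Ψ : Module.End k A)
    (hΨ : ∀ n, ∀ s ∈ V ^ n, Ψ s = (2 : k) ^ n • s) : iSupIndep fun n => V ^ n := by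
  refine (Ψ.eigenspaces_iSupIndep.comp (f := fun n : ℕ => (2 : k) ^ n) ?_).mono
    fun n s hs => ?_
  · intro a b hab
    have : (2 : ℕ) ^ a = 2 ^ b := by
      have h : (2 : k) ^ a = 2 ^ b := hab
      exact_mod_cast h
    exact Nat.pow_right_injective le_rfl this
  · exact Module.End.mem_eigenspace_iff.mpr (hΨ n s hs)

theorem eq_zero_of_sum_mem_iSup {V : ℕ → Submodule k A} (hV : iSupIndep V)
    (N : ℕ) (d : ℕ → A) (hd : ∀ i, d i ∈ V i) (I : Finset ℕ)
    (h : ∑ i ∈ Finset.range N, d i ∈ ⨆ i ∈ I, V i) {i : ℕ} (hi : i < N) (hI : i ∉ I) :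
    d i = 0 := by
  classical
  obtain ⟨μ, hμ⟩ := (Submodule.mem_iSup_finset_iff_exists_sum _ _).mp h
  have h1 := (iSupIndep_iff_finsetSum_eq_imp_eq V).mp hV (Finset.range N ∪ I)
    (fun j => if j ∈ Finset.range N then d j else 0) (fun j => if j ∈ I then (μ j : A) else 0)
    (fun j _ => ⟨by split_ifs <;> simp [hd], by split_ifs <;> simp⟩)
    (by rw [Finset.sum_ite_mem, Finset.sum_ite_mem, Finset.union_inter_cancel_left,
          Finset.union_inter_cancel_right, hμ])
    i (by simp [hi])
  simpa [hi, hI] using h1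

theorem iSup_pow_eq_top (V : Submodule k A) (hV : Algebra.adjoin k (V : Set A) = ⊤) :
    ⨆ n, V ^ n = ⊤ := by
  refine Submodule.eq_top_iff'.mpr fun d => ?_
  have : d ∈ Algebra.adjoin k (V : Set A) := hV ▸ Algebra.mem_top
  induction this using Algebra.adjoin_induction with
  | mem x hx => exact Submodule.mem_iSup_of_mem 1 (by simpa using hx)
  | algebraMap r => exact Submodule.mem_iSup_of_mem 0 (by simp)
  | add x y _ _ hx hy => exact Submodule.add_mem _ hx hy
  | mul x y _ _ hx hy =>
    have h := Submodule.mul_mem_mul hx hy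
    simp only [Submodule.iSup_mul, Submodule.mul_iSup, ← pow_add] at h
    refine (iSup_le fun i => iSup_le fun j => ?_ : _ ≤ ⨆ n, V ^ n) h
    exact le_iSup (fun n => V ^ n) _

theorem mem_of_doubling_eq [CharZero k] (V : Submodule k A) (hV : Algebra.adjoin k (V : Set A) = ⊤)
    (Ψ : Module.End k A) (hΨ : ∀ n, ∀ s ∈ V ^ n, Ψ s = (2 : k) ^ n • s) {d : A}
    (hd : Ψ d = (2 : k) • d) : d ∈ V := by
  have htop : d ∈ ⨆ n, V ^ n := iSup_pow_eq_top V hV ▸ Submodule.mem_top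
  obtain ⟨f, hf, rfl⟩ := (Submodule.mem_iSup_iff_exists_finsupp _ _).mp htop
  have h0 := (iSupIndep_iff_finsetSum_eq_imp_eq _).mp (iSupIndep_pow_of_doubling V Ψ hΨ) f.support
    (fun n => (2 : k) ^ n • f n) (fun n => (2 : k) • f n)
    (fun n _ => ⟨Submodule.smul_mem _ _ (hf n), Submodule.smul_mem _ _ (hf n)⟩)
    (by
      rw [← Finset.smul_sum]
      simp only [Finsupp.sum, map_sum] at hd
      rw [← hd]
      exact Finset.sum_congr rfl fun n _ => (hΨ n _ (hf n)).symm)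
  refine Submodule.sum_mem _ fun n hn => ?_
  by_cases h1 : n = 1
  · subst h1; simpa using hf 1
  · have h2 := h0 n hn
    rw [← sub_eq_zero, ← sub_smul, smul_eq_zero, sub_eq_zero] at h2
    rcases h2 with h2 | h2
    · have h3 : (2 : ℕ) ^ n = 2 ^ 1 := by exact_mod_cast h2
      exact absurd (Nat.pow_right_injective le_rfl h3) h1
    · simp [h2]

end Independence

section MulComm

variable {k A : Type*} [Field k] [CommRing A] [Algebra k A]

/-- The commutator of an operator with multiplication by `a`. -/
def mulComm (P : A →ₗ[k] A) (a : A) : A →ₗ[k] A :=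
  P ∘ₗ LinearMap.mulLeft k a - LinearMap.mulLeft k a ∘ₗ P

@[simp]
theorem mulComm_apply (P : A →ₗ[k] A) (a s : A) : mulComm P a s = P (a * s) - a * P s := rfl

instance : RightCommutative (mulComm (k := k) (A := A)) where
  right_comm P a b := by
    ext s
    simp only [mulComm_apply, mul_left_comm a b]
    ring

/-- The iterated commutator of an operator with multiplications. -/
def iterComm (P : A →ₗ[k] A) (m : Multiset A) : A →ₗ[k] A := m.foldl mulComm P

@[simp]
theorem iterComm_zero (P : A →ₗ[k] A) : iterComm P 0 = P := rfl

@[simp]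
theorem iterComm_cons (P : A →ₗ[k] A) (a : A) (m : Multiset A) :
    iterComm P (a ::ₘ m) = iterComm (mulComm P a) m := Multiset.foldl_cons ..

theorem iterComm_add (P Q : A →ₗ[k] A) (m : Multiset A) :
    iterComm (P + Q) m = iterComm P m + iterComm Q m := by
  induction m using Multiset.induction generalizing P Q with
  | empty => simp
  | cons a m ih =>
    rw [iterComm_cons, iterComm_cons, iterComm_cons, ← ih]
    congr 1
    ext s
    simp
    ring

theorem iterComm_smul (c : k) (P : A →ₗ[k] A) (m : Multiset A) :
    iterComm (c • P) m = c • iterComm P m := by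
  induction m using Multiset.induction generalizing P with
  | empty => simp
  | cons a m ih =>
    rw [iterComm_cons, iterComm_cons, ← ih]
    congr 1
    ext s
    simp [smul_sub]

theorem iterComm_zero_left (m : Multiset A) : iterComm (0 : A →ₗ[k] A) m = 0 := by
  simpa using iterComm_smul (0 : k) (0 : A →ₗ[k] A) m

theorem iterComm_sum {J : Type*} (s : Finset J) (P : J → A →ₗ[k] A) (m : Multiset A) :
    iterComm (∑ j ∈ s, P j) m = ∑ j ∈ s, iterComm (P j) m := by
  classical
  induction s using Finset.induction with
  | empty => simp [iterComm_zero_left]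
  | insert j s hj ih => rw [Finset.sum_insert hj, Finset.sum_insert hj, iterComm_add, ih]

/-- The expansion of the value of an operator on a product through its iterated commutators. -/
theorem apply_prod_eq_sum_iterComm {J : Type*} [DecidableEq J] (P : A →ₗ[k] A) (f : J → A)
    (U : Finset J) :
    P (∏ i ∈ U, f i) = ∑ T ∈ U.powerset, (∏ i ∈ U \ T, f i) * iterComm P (T.val.map f) 1 := by
  induction U using Finset.induction generalizing P with
  | empty => simp
  | insert a U ha ih =>
    have h1 : P (∏ i ∈ insert a U, f i) =
        f a * P (∏ i ∈ U, f i) + mulComm P (f a) (∏ i ∈ U, f i) := by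
      rw [Finset.prod_insert ha, mulComm_apply]; ring
    rw [h1, ih, ih, Finset.sum_powerset_insert ha, Finset.mul_sum]
    congr 1
    · refine Finset.sum_congr rfl fun T hT => ?_
      have haT : a ∉ T := fun h => ha (Finset.mem_powerset.mp hT h)
      rw [Finset.insert_sdiff_of_notMem _ haT, Finset.prod_insert (by simp [ha]), mul_assoc]
    · refine Finset.sum_congr rfl fun T hT => ?_
      have haT : a ∉ T := fun h => ha (Finset.mem_powerset.mp hT h)
      rw [Finset.insert_val_of_notMem haT, Multiset.map_cons, iterComm_cons,
        Finset.insert_sdiff_insert, Finset.sdiff_insert_of_notMem ha]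

/-- The span of the products of between `1` and `r` elements of `V`. -/
def posDegLE (V : Submodule k A) (r : ℕ) : Submodule k A := ⨆ i ∈ Finset.Icc 1 r, V ^ i

theorem posDegLE_mono (V : Submodule k A) {r s : ℕ} (h : r ≤ s) : posDegLE V r ≤ posDegLE V s :=
  biSup_mono fun i hi => by simp only [Finset.mem_Icc] at hi ⊢; omega

theorem pow_le_posDegLE (V : Submodule k A) {i r : ℕ} (h1 : 1 ≤ i) (h : i ≤ r) :
    V ^ i ≤ posDegLE V r :=
  le_iSup₂_of_le (f := fun i (_ : i ∈ Finset.Icc 1 r) => V ^ i) i (Finset.mem_Icc.mpr ⟨h1, h⟩) le_rfl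

theorem mul_mem_posDegLE {V : Submodule k A} {r : ℕ} {a s : A} (ha : a ∈ V)
    (hs : s ∈ posDegLE V r) : a * s ∈ posDegLE V (r + 1) := by
  have h : V * posDegLE V r ≤ posDegLE V (r + 1) := by
    simp only [posDegLE, Submodule.mul_iSup, ← pow_succ']
    refine iSup₂_le fun i hi => pow_le_posDegLE V (by omega) ?_
    have := Finset.mem_Icc.mp hi
    omega
  exact h (Submodule.mul_mem_mul ha hs)

/-- Operators all of whose iterated commutators with multiplication by elements of `V` send `1`
to a combination of products of between `1` and `r` elements of `V`. -/
def coeffDegLE (V : Submodule k A) (r : ℕ) : Submodule k (A →ₗ[k] A) where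
  carrier := {P | ∀ m : Multiset A, (∀ a ∈ m, a ∈ V) → iterComm P m 1 ∈ posDegLE V r}
  zero_mem' m _ := by simp [iterComm_zero_left]
  add_mem' hP hQ m hm := by
    rw [iterComm_add]; exact Submodule.add_mem _ (hP m hm) (hQ m hm)
  smul_mem' c P hP m hm := by
    rw [iterComm_smul]; exact Submodule.smul_mem _ c (hP m hm)

theorem mem_coeffDegLE {V : Submodule k A} {r : ℕ} {P : A →ₗ[k] A} :
    P ∈ coeffDegLE V r ↔
      ∀ m : Multiset A, (∀ a ∈ m, a ∈ V) → iterComm P m 1 ∈ posDegLE V r := Iff.rfl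

theorem mulComm_mem_coeffDegLE {V : Submodule k A} {r : ℕ} {P : A →ₗ[k] A}
    (hP : P ∈ coeffDegLE V r) {a : A} (ha : a ∈ V) : mulComm P a ∈ coeffDegLE V r := by
  intro m hm
  rw [← iterComm_cons]
  exact hP _ (by simpa [ha] using hm)

theorem apply_mem_posDegLE_of_mem_pow {V : Submodule k A} {r : ℕ} {P : A →ₗ[k] A}
    (hP : P ∈ coeffDegLE V r) {j : ℕ} {s : A} (hs : s ∈ V ^ j) : P s ∈ posDegLE V (r + j) := by
  induction j generalizing P s with
  | zero =>
    rw [pow_zero] at hs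
    obtain ⟨c, rfl⟩ := Submodule.mem_one.mp hs
    rw [Algebra.algebraMap_eq_smul_one, map_smul]
    exact Submodule.smul_mem _ _ (by simpa using hP 0 (by simp))
  | succ j ih =>
    rw [pow_succ'] at hs
    induction hs using Submodule.mul_induction_on' with
    | add x _ y _ hx hy => rw [map_add]; exact Submodule.add_mem _ hx hy
    | mem_mul_mem a ha t ht =>
      have h : P (a * t) = a * P t + mulComm P a t := by rw [mulComm_apply]; ring
      rw [h]
      exact Submodule.add_mem _ (mul_mem_posDegLE ha (ih hP ht))
        (posDegLE_mono V (by omega) (ih (mulComm_mem_coeffDegLE hP ha) ht))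

theorem apply_mem_posDegLE {V : Submodule k A} {r j : ℕ} {P : A →ₗ[k] A}
    (hP : P ∈ coeffDegLE V r) {s : A} (hs : s ∈ posDegLE V j) : P s ∈ posDegLE V (r + j) := by
  have h : posDegLE V j ≤ (posDegLE V (r + j)).comap P := iSup₂_le fun i hi s hs =>
    posDegLE_mono V (by have := Finset.mem_Icc.mp hi; omega) (apply_mem_posDegLE_of_mem_pow hP hs)
  exact h hs

theorem comp_mem_coeffDegLE {V : Submodule k A} {r s : ℕ} {P Q : A →ₗ[k] A}
    (hP : P ∈ coeffDegLE V r) (hQ : Q ∈ coeffDegLE V s) : P ∘ₗ Q ∈ coeffDegLE V (r + s) := by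
  intro m
  induction m using Multiset.induction generalizing P Q with
  | empty => exact fun _ => apply_mem_posDegLE hP (by simpa using hQ 0 (by simp))
  | cons a m ih =>
    intro hm
    have ha : a ∈ V := hm a (by simp)
    have hm' : ∀ b ∈ m, b ∈ V := fun b hb => hm b (by simp [hb])
    have h : mulComm (P ∘ₗ Q) a = mulComm P a ∘ₗ Q + P ∘ₗ mulComm Q a := by
      ext t
      simp
    rw [iterComm_cons, h, iterComm_add]
    exact Submodule.add_mem _ (ih (mulComm_mem_coeffDegLE hP ha) hQ hm')
      (ih hP (mulComm_mem_coeffDegLE hQ ha) hm')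

theorem pow_mem_coeffDegLE {V : Submodule k A} {P : Module.End k A}
    (hP : P ∈ coeffDegLE V 1) {r : ℕ} (hr : 1 ≤ r) : P ^ r ∈ coeffDegLE V r := by
  induction r, hr using Nat.le_induction with
  | base => simpa using hP
  | succ r _ ih => rw [pow_succ]; exact comp_mem_coeffDegLE ih hP

/-- `P` sends `V ^ n` to `V ^ (n + r - p)`, and to `0` when `n + r < p`. -/
def IsHomogeneousShift (V : Submodule k A) (r p : ℕ) (P : A →ₗ[k] A) : Prop :=
  ∀ n, ∀ s ∈ V ^ n, P s ∈ V ^ (n + r - p) ∧ (n + r < p → P s = 0)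

theorem IsHomogeneousShift.mulComm {V : Submodule k A} {r p : ℕ} {P : A →ₗ[k] A}
    (hP : IsHomogeneousShift V r p P) {a : A} (ha : a ∈ V) :
    IsHomogeneousShift V (r + 1) p (mulComm P a) := by
  intro n s hs
  have h1 : a * s ∈ V ^ (n + 1) := by rw [pow_succ']; exact Submodule.mul_mem_mul ha hs
  obtain ⟨h2, h3⟩ := hP _ _ h1
  obtain ⟨h4, h5⟩ := hP _ _ hs
  rw [mulComm_apply]
  refine ⟨Submodule.sub_mem _ (by convert h2 using 2; omega) ?_, fun h => ?_⟩
  · by_cases h : n + r < p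
    · simp [h5 h]
    · rw [show n + (r + 1) - p = (n + r - p) + 1 by omega, pow_succ']
      exact Submodule.mul_mem_mul ha h4
  · rw [h3 (by omega), h5 (by omega), mul_zero, sub_zero]

theorem IsHomogeneousShift.iterComm {V : Submodule k A} {p : ℕ} (m : Multiset A)
    (hm : ∀ a ∈ m, a ∈ V) {r : ℕ} {P : A →ₗ[k] A} (hP : IsHomogeneousShift V r p P) :
    IsHomogeneousShift V (r + m.card) p (iterComm P m) := by
  induction m using Multiset.induction generalizing P r with
  | empty => simpa using hP
  | cons a m ih =>
    rw [iterComm_cons, Multiset.card_cons, add_comm m.card, ← add_assoc]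
    exact ih (fun b hb => hm b (by simp [hb])) (hP.mulComm (hm a (by simp)))

theorem iterComm_congr {V : Submodule k A} (m : Multiset A) (hm : ∀ a ∈ m, a ∈ V)
    {P Q : A →ₗ[k] A} {N : ℕ} (h : ∀ n ≤ N + m.card, ∀ s ∈ V ^ n, P s = Q s) :
    ∀ n ≤ N, ∀ s ∈ V ^ n, iterComm P m s = iterComm Q m s := by
  induction m using Multiset.induction generalizing P Q with
  | empty => simpa using h
  | cons a m ih =>
    rw [iterComm_cons, iterComm_cons]
    refine ih (fun b hb => hm b (by simp [hb])) fun n hn s hs => ?_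
    have has : a * s ∈ V ^ (n + 1) := by
      rw [pow_succ']; exact Submodule.mul_mem_mul (hm a (by simp)) hs
    rw [Multiset.card_cons] at h
    rw [mulComm_apply, mulComm_apply, h _ (by omega) _ has, h _ (by omega) _ hs]

end MulComm

section Coproduct

open scoped TensorProduct

variable {k A : Type*} [Field k] [CommRing A] [Algebra k A]

/-- `Δ` sends every power of `v ∈ V` to the same power of `v ⊗ 1 + 1 ⊗ v`. -/
def IsPrimitiveCoproduct (V : Submodule k A) (Δ : A →ₗ[k] A ⊗[k] A) : Prop :=
  ∀ v ∈ V, ∀ n, Δ (v ^ n) = (v ⊗ₜ[k] 1 + 1 ⊗ₜ[k] v) ^ n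

theorem IsPrimitiveCoproduct.map_one {V : Submodule k A} {Δ : A →ₗ[k] A ⊗[k] A}
    (hΔ : IsPrimitiveCoproduct V Δ) : Δ 1 = 1 := by
  simpa using hΔ 0 V.zero_mem 0

theorem IsPrimitiveCoproduct.map_mul_of_mem_pow [CharZero k] {V : Submodule k A}
    {Δ : A →ₗ[k] A ⊗[k] A} (hΔ : IsPrimitiveCoproduct V Δ) {a : A} (ha : a ∈ V) {n : ℕ} {s : A}
    (hs : s ∈ V ^ n) : Δ (a * s) = (a ⊗ₜ[k] 1 + 1 ⊗ₜ[k] a) * Δ s := by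
  let δ : A →ₗ[k] A × (A ⊗[k] A) := LinearMap.id.prod
    ((Algebra.TensorProduct.includeLeft : A →ₐ[k] A ⊗[k] A).toLinearMap +
      (Algebra.TensorProduct.includeRight : A →ₐ[k] A ⊗[k] A).toLinearMap)
  have hδ : ∀ v, δ v = (v, v ⊗ₜ[k] 1 + 1 ⊗ₜ[k] v) := fun v => rfl
  have hgraph : ∀ n, (V.map δ) ^ n ≤ Δ.graph := fun n => by
    refine pow_le_of_forall_pow_mem _ _ n ?_
    rintro _ ⟨v, hv, rfl⟩
    rw [LinearMap.mem_graph_iff, hδ]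
    exact (hΔ v hv n).symm
  have hfst : (V.map δ).map (AlgHom.fst k A (A ⊗[k] A)).toLinearMap = V := by
    rw [← Submodule.map_comp]
    exact Submodule.map_id V
  rw [← hfst, ← Submodule.map_pow] at hs
  obtain ⟨⟨s', t⟩, hst, rfl⟩ := hs
  have h1 : t = Δ s' := (LinearMap.mem_graph_iff _ _).mp (hgraph n hst)
  have h2 : δ a * (s', t) ∈ (V.map δ) ^ (n + 1) := by
    rw [pow_succ']
    exact Submodule.mul_mem_mul (Submodule.mem_map_of_mem ha) hst
  have h3 := (LinearMap.mem_graph_iff _ _).mp (hgraph _ h2)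
  rw [hδ] at h3
  subst h1
  exact h3.symm

theorem IsPrimitiveCoproduct.map_mul [CharZero k] {V : Submodule k A}
    (hV : Algebra.adjoin k (V : Set A) = ⊤) {Δ : A →ₗ[k] A ⊗[k] A}
    (hΔ : IsPrimitiveCoproduct V Δ) {a : A} (ha : a ∈ V) (s : A) :
    Δ (a * s) = (a ⊗ₜ[k] 1 + 1 ⊗ₜ[k] a) * Δ s := by
  have hs : s ∈ ⨆ n, V ^ n := iSup_pow_eq_top V hV ▸ Submodule.mem_top
  induction hs using Submodule.iSup_induction' with
  | mem n s hs => exact hΔ.map_mul_of_mem_pow ha hs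
  | zero => simp
  | add x y _ _ hx hy => rw [mul_add, map_add, map_add, hx, hy, mul_add]

theorem IsPrimitiveCoproduct.doubling [CharZero k] {V : Submodule k A}
    {Δ : A →ₗ[k] A ⊗[k] A} (hΔ : IsPrimitiveCoproduct V Δ) (n : ℕ) :
    ∀ s ∈ V ^ n, Algebra.TensorProduct.lmul' (S := A) k (Δ s) = (2 : k) ^ n • s := by
  induction n with
  | zero =>
    intro s hs
    rw [pow_zero] at hs
    obtain ⟨c, rfl⟩ := Submodule.mem_one.mp hs
    rw [Algebra.algebraMap_eq_smul_one, map_smul, hΔ.map_one]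
    simp
  | succ n ih =>
    intro s hs
    rw [pow_succ'] at hs
    induction hs using Submodule.mul_induction_on' with
    | add x _ y _ hx hy => rw [map_add, map_add, hx, hy, smul_add]
    | mem_mul_mem a ha t ht =>
      rw [hΔ.map_mul_of_mem_pow ha ht, _root_.map_mul, ih t ht, pow_succ', mul_smul, two_smul,
        ← smul_add]
      simp [add_mul, smul_add]

/-- `P` is a coderivation with respect to `Δ`. -/
def IsCoderivation (Δ : A →ₗ[k] A ⊗[k] A) (P : A →ₗ[k] A) : Prop :=
  ∀ s, Δ (P s) = P.rTensor A (Δ s) + P.lTensor A (Δ s)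

theorem IsCoderivation.mulComm [CharZero k] {V : Submodule k A}
    (hV : Algebra.adjoin k (V : Set A) = ⊤) {Δ : A →ₗ[k] A ⊗[k] A}
    (hΔ : IsPrimitiveCoproduct V Δ) {P : A →ₗ[k] A} (hP : IsCoderivation Δ P) {a : A}
    (ha : a ∈ V) : IsCoderivation Δ (mulComm P a) := by
  intro s
  rw [mulComm_apply, map_sub, hP, hΔ.map_mul hV ha, hΔ.map_mul hV ha, hP]
  induction Δ s using TensorProduct.induction_on with
  | zero => simp
  | add x y hx hy =>
    simp only [mul_add, map_add] at hx hy ⊢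
    rw [← sub_eq_zero] at hx hy ⊢
    linear_combination hx + hy
  | tmul u v =>
    simp only [add_mul, Algebra.TensorProduct.tmul_mul_tmul, one_mul, map_add,
      LinearMap.rTensor_tmul, LinearMap.lTensor_tmul, mul_add, mulComm_apply,
      TensorProduct.sub_tmul, TensorProduct.tmul_sub]
    ring

theorem IsCoderivation.mem_coeffDegLE [CharZero k] {V : Submodule k A}
    (hV : Algebra.adjoin k (V : Set A) = ⊤) {Δ : A →ₗ[k] A ⊗[k] A}
    (hΔ : IsPrimitiveCoproduct V Δ) {P : A →ₗ[k] A} (hP : IsCoderivation Δ P) :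
    P ∈ coeffDegLE V 1 := by
  intro m
  induction m using Multiset.induction generalizing P with
  | empty =>
    intro _
    refine pow_le_posDegLE V le_rfl le_rfl ?_
    rw [pow_one]
    refine mem_of_doubling_eq V hV ((Algebra.TensorProduct.lmul' (S := A) k).toLinearMap ∘ₗ Δ)
      (fun n s hs => hΔ.doubling n s hs) ?_
    rw [LinearMap.comp_apply, iterComm_zero, hP, hΔ.map_one, Algebra.TensorProduct.one_def]
    simp [two_smul]
  | cons a m ih =>
    intro hm
    rw [iterComm_cons]
    exact ih (hP.mulComm hV hΔ (hm a (by simp))) fun b hb => hm b (by simp [hb])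

end Coproduct

section Enveloping

attribute [local instance] LieRing.ofAssociativeRing

open scoped TensorProduct

variable (k L : Type) [Field k] [LieRing L] [LieAlgebra k L]

/-- The coproduct of the universal enveloping algebra. -/
def envelopingCoproduct : UniversalEnvelopingAlgebra k L →ₐ[k]
    UniversalEnvelopingAlgebra k L ⊗[k] UniversalEnvelopingAlgebra k L :=
  UniversalEnvelopingAlgebra.lift k
    { toFun := fun g => UniversalEnvelopingAlgebra.ι k g ⊗ₜ[k] 1 +
        1 ⊗ₜ[k] UniversalEnvelopingAlgebra.ι k g
      map_add' := fun a b => by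
        simp only [map_add, TensorProduct.add_tmul, TensorProduct.tmul_add]
        abel
      map_smul' := fun c a => by
        simp [TensorProduct.smul_tmul']
      map_lie' := fun {a b} => by
        simp only [LieHom.map_lie, LieRing.of_associative_ring_bracket, add_mul, mul_add,
          Algebra.TensorProduct.tmul_mul_tmul, one_mul, mul_one, TensorProduct.sub_tmul,
          TensorProduct.tmul_sub]
        abel }

theorem envelopingCoproduct_ι (g : L) :
    envelopingCoproduct k L (UniversalEnvelopingAlgebra.ι k g) =
      UniversalEnvelopingAlgebra.ι k g ⊗ₜ[k] 1 + 1 ⊗ₜ[k] UniversalEnvelopingAlgebra.ι k g :=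
  UniversalEnvelopingAlgebra.lift_ι_apply' ..

variable {k L} {S : Type} [CommRing S] [Algebra k S]

/-- Right multiplication by `u` in the enveloping algebra, transported along `E`. -/
def transportMulRight (E : S ≃ₗ[k] UniversalEnvelopingAlgebra k L)
    (u : UniversalEnvelopingAlgebra k L) : S →ₗ[k] S :=
  E.symm.toLinearMap ∘ₗ LinearMap.mulRight k u ∘ₗ E.toLinearMap

@[simp]
theorem transportMulRight_apply (E : S ≃ₗ[k] UniversalEnvelopingAlgebra k L)
    (u : UniversalEnvelopingAlgebra k L) (s : S) :
    transportMulRight E u s = E.symm (E s * u) := rfl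

/-- The coproduct of the enveloping algebra, transported along `E`. -/
def transportCoproduct (E : S ≃ₗ[k] UniversalEnvelopingAlgebra k L) : S →ₗ[k] S ⊗[k] S :=
  TensorProduct.map E.symm.toLinearMap E.symm.toLinearMap ∘ₗ
    (envelopingCoproduct k L).toLinearMap ∘ₗ E.toLinearMap

theorem transportCoproduct_apply (E : S ≃ₗ[k] UniversalEnvelopingAlgebra k L) (s : S) :
    transportCoproduct E s = TensorProduct.map E.symm.toLinearMap E.symm.toLinearMap
      (envelopingCoproduct k L (E s)) := rfl

theorem isPrimitiveCoproduct_transportCoproduct (ι : L →ₗ[k] S)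
    (E : S ≃ₗ[k] UniversalEnvelopingAlgebra k L)
    (hE : ∀ g n, E (ι g ^ n) = UniversalEnvelopingAlgebra.ι k g ^ n) :
    IsPrimitiveCoproduct (LinearMap.range ι) (transportCoproduct E) := by
  rintro _ ⟨g, rfl⟩ n
  have hE' : ∀ n, E.symm (UniversalEnvelopingAlgebra.ι k g ^ n) = ι g ^ n := fun n => by
    rw [← hE, E.symm_apply_apply]
  have hcomm : Commute (UniversalEnvelopingAlgebra.ι k g ⊗ₜ[k] (1 : UniversalEnvelopingAlgebra k L))
      ((1 : UniversalEnvelopingAlgebra k L) ⊗ₜ[k] UniversalEnvelopingAlgebra.ι k g) := by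
    simp [Commute, SemiconjBy]
  rw [transportCoproduct_apply, hE, map_pow, envelopingCoproduct_ι, hcomm.add_pow, add_pow, map_sum]
  refine Finset.sum_congr rfl fun i _ => ?_
  rw [← nsmul_eq_mul', ← nsmul_eq_mul', map_nsmul]
  rw [Algebra.TensorProduct.tmul_pow, Algebra.TensorProduct.tmul_pow,
    Algebra.TensorProduct.tmul_pow, Algebra.TensorProduct.tmul_pow]
  simp only [one_pow, Algebra.TensorProduct.tmul_mul_tmul, one_mul, mul_one, TensorProduct.map_tmul,
    LinearEquiv.coe_coe, hE']

theorem isCoderivation_transportMulRight (E : S ≃ₗ[k] UniversalEnvelopingAlgebra k L) (g : L) :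
    IsCoderivation (transportCoproduct E)
      (transportMulRight E (UniversalEnvelopingAlgebra.ι k g)) := by
  intro s
  rw [transportCoproduct_apply, transportCoproduct_apply, transportMulRight_apply,
    E.apply_symm_apply, map_mul, envelopingCoproduct_ι]
  induction envelopingCoproduct k L (E s) using TensorProduct.induction_on with
  | zero => simp
  | add x y hx hy =>
    simp only [add_mul, map_add] at hx hy ⊢
    rw [hx, hy]
    abel
  | tmul u v => simp [mul_add]

theorem transportMulRight_pow (E : S ≃ₗ[k] UniversalEnvelopingAlgebra k L)
    (u : UniversalEnvelopingAlgebra k L) (r : ℕ) :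
    transportMulRight E (u ^ r) = (transportMulRight E u : Module.End k S) ^ r := by
  induction r with
  | zero => ext s; simp
  | succ r ih =>
    rw [pow_succ', pow_succ' (transportMulRight E u : Module.End k S), ← ih]
    ext s
    simp [(Commute.self_pow u r).eq, mul_assoc]

theorem IsSymmAlg.adjoin_range_eq_top {ι : L →ₗ[k] S} (hS : IsSymmAlg k L S ι) :
    Algebra.adjoin k (LinearMap.range ι : Set S) = ⊤ := by
  rw [LinearMap.coe_range]
  exact hS

theorem transportMulRight_mem_coeffDegLE [CharZero k] (ι : L →ₗ[k] S)
    (hS : IsSymmAlg k L S ι) (E : S ≃ₗ[k] UniversalEnvelopingAlgebra k L)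
    (hE : ∀ g n, E (ι g ^ n) = UniversalEnvelopingAlgebra.ι k g ^ n) {r : ℕ} (hr : 1 ≤ r)
    {s : S} (hs : s ∈ LinearMap.range ι ^ r) :
    transportMulRight E (E s) ∈ coeffDegLE (LinearMap.range ι) r := by
  let F : S →ₗ[k] S →ₗ[k] S :=
    { toFun := fun s => transportMulRight E (E s)
      map_add' := fun a b => by ext; simp [mul_add]
      map_smul' := fun c a => by ext; simp }
  have h := pow_le_of_forall_pow_mem (LinearMap.range ι)
    ((coeffDegLE (LinearMap.range ι) r).comap F) r (by
      rintro _ ⟨g, rfl⟩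
      change transportMulRight E (E (ι g ^ r)) ∈ coeffDegLE (LinearMap.range ι) r
      rw [hE, transportMulRight_pow]
      exact pow_mem_coeffDegLE ((isCoderivation_transportMulRight E g).mem_coeffDegLE
        hS.adjoin_range_eq_top (isPrimitiveCoproduct_transportCoproduct ι E hE)) hr)
  exact h hs

theorem IsSymmetrization.map_pow [CharZero k] {ι : L →ₗ[k] S}
    {e : S →ₗ[k] UniversalEnvelopingAlgebra k L}
    (he : IsSymmetrization k L S ι e) (g : L) (n : ℕ) :
    e (ι g ^ n) = UniversalEnvelopingAlgebra.ι k g ^ n := by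
  have h := he (List.replicate n g)
  have hn : (n.factorial : k) ≠ 0 := by exact_mod_cast n.factorial_ne_zero
  simp only [List.map_replicate, List.prod_replicate, List.get_eq_getElem, List.getElem_replicate,
    List.ofFn_const, List.length_replicate, Finset.sum_const, Finset.card_univ,
    Fintype.card_perm, Fintype.card_fin] at h
  rw [h, ← Nat.cast_smul_eq_nsmul k, smul_smul, inv_mul_cancel₀ hn, one_smul]

end Enveloping

section Combinatorics

theorem sum_paperC_mul_choose (q j : ℕ) :
    ∑ l ∈ Finset.range (j + 1), paperC q l * ((q + j).choose (q + l) : ℚ) = 1 := by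
  have hsymm : ∀ l ∈ Finset.range (j + 1),
      paperC q l * ((q + j).choose (q + l) : ℚ) = paperC q l * ((q + j).choose (j - l) : ℚ) := by
    intro l hl
    rw [Finset.mem_range] at hl
    rw [← Nat.choose_symm (by omega : q + l ≤ q + j), show q + j - (q + l) = j - l by omega]
  rw [Finset.sum_congr rfl hsymm]
  cases j with
  | zero => simp [paperC]
  | succ j =>
    rw [Finset.sum_range_succ, paperC, Fin.sum_univ_eq_sum_range
      (fun l => paperC q l * ((q + (j + 1)).choose (j + 1 - l) : ℚ))]
    simp

theorem sum_range_paperC_mul_choose (q : ℕ) {j r : ℕ} (hj : j < r) :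
    ∑ c ∈ Finset.range r, paperC q c * ((q + j).choose (q + c) : ℚ) = 1 := by
  rw [← sum_paperC_mul_choose q j]
  refine (Finset.sum_subset (Finset.range_mono (by omega : j + 1 ≤ r)) fun c _ hc => ?_).symm
  rw [Finset.mem_range] at hc
  rw [Nat.choose_eq_zero_of_lt (by omega)]
  simp

variable {A J : Type*} [CommRing A] [Fintype J] [DecidableEq J]

theorem sum_powersetCard_mul_sum_powerset (f : J → A) (D : Finset J → A) (m : ℕ) :
    ∑ W ∈ Finset.powersetCard m (Finset.univ : Finset J), (∏ i ∈ W, f i) *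
        ∑ T ∈ Wᶜ.powerset, (∏ i ∈ Wᶜ \ T, f i) * D T =
      ∑ T : Finset J, (Tᶜ.card.choose m : A) * ((∏ i ∈ Tᶜ, f i) * D T) := by
  simp_rw [Finset.mul_sum]
  rw [Finset.sum_comm' (t' := Finset.univ) (s' := fun T => Finset.powersetCard m Tᶜ)]
  · refine Finset.sum_congr rfl fun T _ => ?_
    rw [← Finset.card_powersetCard, ← nsmul_eq_mul, ← Finset.sum_const]
    refine Finset.sum_congr rfl fun W hW => ?_
    rw [← mul_assoc, mul_comm (∏ i ∈ W, f i), show Wᶜ \ T = Tᶜ \ W by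
      ext; simp [and_comm], Finset.prod_sdiff (Finset.mem_powersetCard.mp hW).1]
  · intro W T
    simp only [Finset.mem_powersetCard, Finset.mem_powerset, Finset.mem_univ, and_true,
      Finset.subset_univ, true_and]
    rw [Finset.subset_compl_comm, and_comm]

end Combinatorics

section Vanishing

theorem prod_mem_pow_card {k A J : Type*} [CommSemiring k] [CommSemiring A] [Algebra k A]
    (V : Submodule k A) (s : Finset J) (f : J → A) (hf : ∀ j ∈ s, f j ∈ V) :
    ∏ j ∈ s, f j ∈ V ^ s.card := by
  classical
  induction s using Finset.induction with
  | empty => simpa using (Submodule.one_le (P := (1 : Submodule k A))).mp le_rfl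
  | insert j s hj ih =>
    rw [Finset.prod_insert hj, Finset.card_insert_of_notMem hj, pow_succ']
    exact Submodule.mul_mem_mul (hf j (by simp)) (ih fun i hi => hf i (by simp [hi]))

variable {k L S : Type} [Field k] [CharZero k] [LieRing L] [LieAlgebra k L] [CommRing S]
  [Algebra k S]

theorem iterComm_apply_one_eq_zero {ι : L →ₗ[k] S} (hS : IsSymmAlg k L S ι)
    {e : S →ₗ[k] UniversalEnvelopingAlgebra k L} (he : IsSymmetrization k L S ι e)
    (hbij : Function.Bijective e) {B : ℕ → S →ₗ[k] S →ₗ[k] S}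
    (hB : IsPBWComponents k L S ι e B) {p r : ℕ} (hr : 1 ≤ r) {t : S}
    (ht : t ∈ LinearMap.range ι ^ r) (m : Multiset S) (hm : ∀ a ∈ m, a ∈ LinearMap.range ι)
    (hp : m.card + r ≤ p ∨ p < m.card) : iterComm ((B p).flip t) m 1 = 0 := by
  set V := LinearMap.range ι with hV
  have hone : (1 : S) ∈ V ^ 0 := by rw [pow_zero]; exact Submodule.one_le.mp le_rfl
  obtain ⟨hB1, hB2, hB3⟩ := hB
  let E := LinearEquiv.ofBijective e hbij
  have hE : ∀ g n, E (ι g ^ n) = UniversalEnvelopingAlgebra.ι k g ^ n := he.map_pow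
  have hshift : ∀ p, IsHomogeneousShift V r p ((B p).flip t) := fun p n s hs =>
    ⟨hB1 p n r s hs t ht, fun h => hB2 p n r h s hs t ht⟩
  have hval : ∀ p, iterComm ((B p).flip t) m 1 ∈ V ^ (m.card + r - p) ∧
      (m.card + r < p → iterComm ((B p).flip t) m 1 = 0) := fun p => by
    have h := (hshift p).iterComm m hm 0 1 hone
    rwa [zero_add, add_comm r] at h
  by_cases hlt : m.card + r < p
  · exact (hval p).2 hlt
  set N := m.card + r with hN
  have hsum : ∑ p ∈ Finset.range (N + 1), iterComm ((B p).flip t) m 1 ∈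
      ⨆ i ∈ Finset.Icc 1 r, V ^ i := by
    have h1 : ∀ n ≤ 0 + m.card, ∀ s ∈ V ^ n,
        (∑ p ∈ Finset.range (N + 1), (B p).flip t) s = transportMulRight E (E t) s := by
      intro n hn s hs
      rw [transportMulRight_apply, LinearEquiv.eq_symm_apply]
      refine Eq.trans (congrArg E ?_) (hB3 n r s hs t ht)
      rw [LinearMap.sum_apply]
      refine (Finset.sum_subset (Finset.range_mono (by omega)) fun p _ h => ?_).symm
      exact ((hshift p) n s hs).2 (by rw [Finset.mem_range] at h; omega)
    have h2 := iterComm_congr m hm h1 0 le_rfl 1 hone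
    rw [iterComm_sum, LinearMap.sum_apply] at h2
    rw [h2]
    exact mem_coeffDegLE.mp (transportMulRight_mem_coeffDegLE ι hS E hE hr ht) m hm
  rw [← Finset.sum_range_reflect] at hsum
  have hind : iSupIndep fun n => V ^ n := iSupIndep_pow_of_doubling V
    ((Algebra.TensorProduct.lmul' (S := S) k).toLinearMap ∘ₗ transportCoproduct E)
    (isPrimitiveCoproduct_transportCoproduct ι E hE).doubling
  have h := eq_zero_of_sum_mem_iSup hind (N + 1)
    (fun i => if i ≤ N then iterComm ((B (N + 1 - 1 - i)).flip t) m 1 else 0)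
    (fun i => by
      split_ifs with hi
      · convert (hval (N + 1 - 1 - i)).1 using 2
        omega
      · simp)
    (Finset.Icc 1 r)
    (by
      rw [Finset.sum_congr rfl fun i hi => if_pos (Nat.lt_succ_iff.mp (Finset.mem_range.mp hi))]
      exact hsum)
    (i := N - p) (by omega) (by rw [Finset.mem_Icc]; omega)
  rw [if_pos (by omega), show N + 1 - 1 - (N - p) = p by omega] at h
  exact h

end Vanishing

/-- Lemma 2.0 of the paper: for `p ≥ 1`, `q ≥ 0`, `r ≥ 1` and
`x_1,…,x_{p+q}, y_1,…,y_r ∈ 𝔤`,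
`B_p(x_1⋯x_{p+q}, y_1⋯y_r) = ∑_{k=0}^{r-1} c_k(q) ∑_{#S = q+k} x_S B_p(x_{S^c}, y_1⋯y_r)`,
the inner sum being over subsets `S ⊆ {1,…,p+q}` of cardinality `q+k`. -/
theorem lemma_2_0 (k : Type) [Field k] [CharZero k]
    (L : Type) [LieRing L] [LieAlgebra k L]
    (S : Type) [CommRing S] [Algebra k S] (ι : L →ₗ[k] S)
    (hS : IsSymmAlg k L S ι)
    (e : S →ₗ[k] UniversalEnvelopingAlgebra k L)
    (he : IsSymmetrization k L S ι e) (hbij : Function.Bijective e)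
    (B : ℕ → S →ₗ[k] S →ₗ[k] S) (hB : IsPBWComponents k L S ι e B)
    (p q r : ℕ) (hp : 1 ≤ p) (hr : 1 ≤ r)
    (x : Fin (p + q) → L) (y : Fin r → L) :
    B p (∏ i, ι (x i)) (∏ j, ι (y j)) =
      ∑ c ∈ Finset.range r, ((paperC q c : ℚ) : k) •
        ∑ T ∈ Finset.powersetCard (q + c) (Finset.univ : Finset (Fin (p + q))),
          (∏ i ∈ T, ι (x i)) * B p (∏ i ∈ Tᶜ, ι (x i)) (∏ j, ι (y j)) := by
  classical
  set D : Finset (Fin (p + q)) → S := fun T =>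
    iterComm ((B p).flip (∏ j, ι (y j))) (T.val.map fun i => ι (x i)) 1 with hD
  have hy : ∏ j, ι (y j) ∈ LinearMap.range ι ^ r := by
    simpa using prod_mem_pow_card (LinearMap.range ι) Finset.univ (fun j => ι (y j))
      fun j _ => LinearMap.mem_range_self ι (y j)
  have hexp : ∀ U : Finset (Fin (p + q)), B p (∏ i ∈ U, ι (x i)) (∏ j, ι (y j)) =
      ∑ T ∈ U.powerset, (∏ i ∈ U \ T, ι (x i)) * D T :=
    apply_prod_eq_sum_iterComm ((B p).flip (∏ j, ι (y j))) fun i => ι (x i)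
  have hvan : ∀ T : Finset (Fin (p + q)), T.card + r ≤ p ∨ p < T.card → D T = 0 := fun T hT =>
    iterComm_apply_one_eq_zero hS he hbij hB hr hy _
      (by simp only [Multiset.mem_map]; rintro _ ⟨i, _, rfl⟩; exact LinearMap.mem_range_self ι _)
      (by simpa using hT)
  simp_rw [hexp]
  simp_rw [sum_powersetCard_mul_sum_powerset (fun i => ι (x i)) D, Finset.smul_sum]
  rw [Finset.sum_comm, Finset.powerset_univ]
  refine Finset.sum_congr rfl fun T _ => ?_
  by_cases hT : T.card + r ≤ p ∨ p < T.card
  · simp [hvan T hT]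
  · have hcard : Tᶜ.card = q + (p - T.card) := by
      rw [Finset.card_compl, Fintype.card_fin]; omega
    have hc := congrArg (Rat.cast : ℚ → k) (sum_range_paperC_mul_choose q
      (by omega : p - T.card < r))
    push_cast at hc
    simp only [← map_natCast (algebraMap k S), ← Algebra.smul_def, smul_smul, hcard]
    rw [← Finset.sum_smul, hc, one_smul, Finset.compl_eq_univ_sdiff]

end
end

section
/- For all integers q ≥ 1 and m ≥ 0, one has 0 = (-1)^m + Σ_{t=1}^{q} binom(m+q, m+t)·(-1)^t·c_m(t). -/
/-- The coefficient of `X ^ k` in `(1 + X) ^ (-(p + 1)) * (1 + X) ^ (p + 1 + k) = (1 + X) ^ k`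
is `1`. -/
theorem sum_neg_one_pow_mul_choose_mul_choose (p k : ℕ) :
    ∑ l ∈ Finset.range (k + 1),
      (-1 : ℚ) ^ l * ((p + l).choose l : ℚ) * ((p + 1 + k).choose (k - l) : ℚ) = 1 := by
  have hneg (l : ℕ) : Ring.choose (-((p : ℤ) + 1)) l = (-1) ^ l * ((p + l).choose l : ℤ) := by
    rw [Ring.choose_neg, show (p : ℤ) + 1 + l - 1 = ((p + l : ℕ) : ℤ) by push_cast; ring,
      Ring.choose_natCast, Units.smul_def, smul_eq_mul]
    simp [Int.negOnePow]
  have h := Ring.add_choose_eq k (Commute.all (-((p : ℤ) + 1)) ((p + 1 + k : ℕ) : ℤ))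
  rw [show -((p : ℤ) + 1) + ((p + 1 + k : ℕ) : ℤ) = (k : ℤ) by push_cast; ring,
    Ring.choose_natCast, Nat.choose_self, Finset.Nat.sum_antidiagonal_eq_sum_range_succ_mk] at h
  simp only [hneg, Ring.choose_natCast] at h
  exact_mod_cast h.symm

/-- For `q ≥ 1` the recursion is solved by `c_k(q) = (-1) ^ k * (q + k - 1).choose k`. -/
theorem paperC_succ (p k : ℕ) : paperC (p + 1) k = (-1) ^ k * ((p + k).choose k : ℚ) := by
  induction k using Nat.strong_induction_on with
  | _ k ih =>
    cases k with
    | zero => simp [paperC]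
    | succ k =>
      have h := sum_neg_one_pow_mul_choose_mul_choose p (k + 1)
      rw [Finset.sum_range_succ, Nat.sub_self, Nat.choose_zero_right, Nat.cast_one, mul_one] at h
      rw [paperC, Fin.sum_univ_eq_sum_range
        (fun l => paperC (p + 1) l * ((p + 1 + (k + 1)).choose (k + 1 - l) : ℚ)),
        Finset.sum_congr rfl fun l hl => by rw [ih l (Finset.mem_range.mp hl)]]
      linarith

/-- Lemma 2.1 of the paper: for all integers `q ≥ 1` and `m ≥ 0`,
`0 = (-1)^m + ∑_{t=1}^{q} binom(m+q, m+t) * (-1)^t * c_m(t)`. -/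
theorem lemma_2_1 (q m : ℕ) (hq : 1 ≤ q) :
    (0 : ℚ) = (-1) ^ m +
      ∑ t ∈ Finset.Icc 1 q, ((m + q).choose (m + t) : ℚ) * (-1) ^ t * paperC t m := by
  obtain ⟨n, rfl⟩ := Nat.exists_eq_add_of_le' hq
  have h := sum_neg_one_pow_mul_choose_mul_choose m n
  have hsum : ∑ t ∈ Finset.Icc 1 (n + 1),
        ((m + (n + 1)).choose (m + t) : ℚ) * (-1) ^ t * paperC t m =
      -(-1) ^ m * ∑ l ∈ Finset.range (n + 1),
        (-1 : ℚ) ^ l * ((m + l).choose l : ℚ) * ((m + 1 + n).choose (n - l) : ℚ) := by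
    rw [← Finset.Ico_add_one_right_eq_Icc, Finset.sum_Ico_eq_sum_range, Finset.mul_sum]
    refine Finset.sum_congr (by simp) fun l hl => ?_
    have hln : l ≤ n := by simpa [Nat.lt_succ_iff] using hl
    rw [add_comm 1 l, paperC_succ,
      Nat.choose_symm_of_eq_add (show m + (n + 1) = (m + (l + 1)) + (n - l) by omega),
      show m + (n + 1) = m + 1 + n by omega,
      add_comm l m, Nat.choose_symm_add]
    ring
  rw [hsum, h]
  ring
end
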